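/- Let K = ⋃_{n≥1} ℚ(3^{1/3^n}) ⊆ \overline{ℚ}, where 3^{1/3^n} denotes the positive real 3^n-th root of 3. Let p_1 < p_2 < ⋯ be an infinite strictly increasing sequence of rational primes with p_1 > 3 and each p_n ≡ 3 (mod 4). Set K_0 = K and K_n = K_{n−1}(√p_n) for n ≥ 1, and let L = ⋃_n K_n. Then for each n ≥ 1, every γ ∈ K_n^× \ K_{n−1} satisfies H(γ) ≥ (p_n/4)^{1/4}; consequently every γ ∈ L^× \ K^× satisfies H(γ) ≥ (p_1/4)^{1/4}, and L/K is an infinite Bogomolov extension, while K does not satisfy the Bogomolov property (B). -/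

import Mathlib

open NumberField IntermediateField
open scoped Classical

noncomputable section

namespace RelBogomolov

/-- The "denominator ideal" of an element `x` of a field `K`: the ideal of integers `a` of `K`
such that `a * x` is an algebraic integer.  For a number field `K`, the logarithm of its absolute
norm is the finite (non-archimedean) part `∑_{v finite} log max (1, |x|_v)` of the Weil height. -/
def denomIdeal (K : Type*) [Field K] (x : K) : Ideal (𝓞 K) where
  carrier := {a | IsIntegral ℤ ((a : K) * x)}
  add_mem' := by
    intro a b ha hb
    have := ha.add hb
    simpa [add_mul] using this
  zero_mem' := by
    simpa using isIntegral_zero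
  smul_mem' := by
    intro c a ha
    have hc : IsIntegral ℤ (c : K) := RingOfIntegers.isIntegral_coe c
    simpa [smul_eq_mul, mul_assoc] using hc.mul ha

/-- The absolute logarithmic Weil height of an element of a number field `K`:
`h(x) = (1/[K:ℚ]) (∑_{v archimedean} [K_v : ℚ_v] log max (1, |x|_v)
          + ∑_{v finite} [K_v : ℚ_v] log max (1, |x|_v))`,
where the finite part is expressed as the log of the absolute norm of the denominator ideal. -/
def nfHeight (K : Type*) [Field K] [NumberField K] (x : K) : ℝ :=
  (Module.finrank ℚ K : ℝ)⁻¹ *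
    ((∑ w : InfinitePlace K, (w.mult : ℝ) * Real.log (max 1 (w x))) +
      Real.log (Ideal.absNorm (denomIdeal K x)))

/-- The absolute logarithmic Weil height of a complex number that is algebraic over `ℚ`,
computed in the number field `ℚ(x)` (junk value `0` for transcendental numbers). -/
def algHeight (x : ℂ) : ℝ :=
  if hx : IsIntegral ℚ x then
    letI : FiniteDimensional ℚ ℚ⟮x⟯ := adjoin.finiteDimensional hx
    haveI : CharZero ℚ⟮x⟯ := charZero_of_injective_algebraMap (algebraMap ℚ ℚ⟮x⟯).injective
    haveI : NumberField ℚ⟮x⟯ := ⟨⟩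
    nfHeight ℚ⟮x⟯ (AdjoinSimple.gen ℚ x)
  else 0

/-- The multiplicative Weil height `H(x) = exp h(x)`. -/
def mulHeight (x : ℂ) : ℝ := Real.exp (algHeight x)

/-- A fixed algebraic closure of `ℚ`: the field of algebraic numbers inside `ℂ`. -/
def Qbar : IntermediateField ℚ ℂ := _root_.algebraicClosure ℚ ℂ

/-- A subfield `K` of `ℚ̄` has the Bogomolov property (B) if there is `ε > 0` such that no
nonzero element of `K` has height strictly between `0` and `ε`. -/
def HasBogomolovProperty (K : IntermediateField ℚ ℂ) : Prop :=
  ∃ ε : ℝ, 0 < ε ∧ ∀ x : ℂ, x ∈ K → x ≠ 0 → ¬(0 < algHeight x ∧ algHeight x < ε)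

/-- The extension `L/K` is Bogomolov if there is `ε > 0` such that every nonzero `x ∈ L`
with `0 < h(x) < ε` lies in `K`. -/
def IsBogomolovExtension (K L : IntermediateField ℚ ℂ) : Prop :=
  ∃ ε : ℝ, 0 < ε ∧ ∀ x : ℂ, x ∈ L → x ≠ 0 → 0 < algHeight x → algHeight x < ε → x ∈ K

/-- `δ(M)`: the number of archimedean places of `M` (junk value `0` in the infinite case). -/
def archPlaces (M : IntermediateField ℚ ℂ) : ℕ :=
  if h : FiniteDimensional ℚ ↥M then
    letI := h
    haveI : CharZero ↥M := charZero_of_injective_algebraMap (algebraMap ℚ ↥M).injective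
    haveI : NumberField ↥M := ⟨⟩
    Fintype.card (InfinitePlace ↥M)
  else 0

/-- The absolute norm `N_{F/ℚ}` of an ideal of the ring of integers of a subfield `F ⊆ ℚ̄`
(junk value `0` in the infinite case). -/
def idealNorm {F : IntermediateField ℚ ℂ} (I : Ideal (𝓞 ↥F)) : ℕ :=
  if h : FiniteDimensional ℚ ↥F then
    letI := h
    haveI : CharZero ↥F := charZero_of_injective_algebraMap (algebraMap ℚ ↥F).injective
    haveI : NumberField ↥F := ⟨⟩
    Ideal.absNorm I
  else 0

/-- The relative discriminant ideal `D_{F'/F}` of an extension of number fields, defined as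
the ideal of `𝓞 F` generated by the discriminants of all `[F':F]`-tuples of integers of `F'`. -/
def relDiscrNF (F F' : Type*) [Field F] [Field F'] [Algebra F F'] : Ideal (𝓞 F) :=
  Ideal.span {d : 𝓞 F | ∃ x : Fin (Module.finrank F F') → 𝓞 F', d = Algebra.discr (𝓞 F) x}

/-- The relative discriminant ideal `D_{C/F}` for subfields `F ≤ C` of `ℚ̄`
(junk value `⊥` if `F ≰ C`). -/
def relDiscr (F C : IntermediateField ℚ ℂ) : Ideal (𝓞 ↥F) :=
  if h : F ≤ C then
    letI : Algebra ↥F ↥C := (IntermediateField.inclusion h).toAlgebra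
    relDiscrNF ↥F ↥C
  else ⊥

/-- The inclusion `𝓞 F →+* 𝓞 M` of rings of integers induced by an inclusion `F ≤ M` of
subfields of `ℚ̄`. -/
def intInclusion {F M : IntermediateField ℚ ℂ} (h : F ≤ M) : 𝓞 ↥F →+* 𝓞 ↥M :=
  RingOfIntegers.mapRingHom (IntermediateField.inclusion h)

/-- `ρ(K/F)`: the least real number `ρ` such that every finite subextension `M` of `K/F` is
contained in a finite subextension `M'` of `K/F` with `δ(M')/[M':F] ≤ ρ`. -/
def rho (F K : IntermediateField ℚ ℂ) : ℝ :=
  sInf {r : ℝ | ∀ M : IntermediateField ℚ ℂ, F ≤ M → M ≤ K → FiniteDimensional ℚ ↥M →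
    ∃ M' : IntermediateField ℚ ℂ, M ≤ M' ∧ M' ≤ K ∧ FiniteDimensional ℚ ↥M' ∧
      (archPlaces M' : ℝ) / (relfinrank F M' : ℝ) ≤ r}

/-- The norm excess discriminant `E(K, C/F)`: the infimum over finite subextensions `M` of
`K/F` (with `e = [M:F]`, `s = [C:F]`) of
`N_{F/ℚ}(D_{C/F}^e / gcd(D_{C/F}^e, D_{M/F}^s))^{1/e}`; here the gcd of two ideals is their
sup, and the norm of the quotient ideal is the quotient of the norms. -/
def normExcess (K F C : IntermediateField ℚ ℂ) : ℝ :=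
  sInf {r : ℝ | ∃ M : IntermediateField ℚ ℂ, F ≤ M ∧ M ≤ K ∧ FiniteDimensional ℚ ↥M ∧
    r = ((idealNorm ((relDiscr F C) ^ (relfinrank F M)) : ℝ) /
          (idealNorm ((relDiscr F C) ^ (relfinrank F M) ⊔ (relDiscr F M) ^ (relfinrank F C)) : ℝ))
        ^ ((relfinrank F M : ℝ)⁻¹)}

/-- `a(𝔭)`: the greatest `k` such that `x^ℓ ≡ α (mod 𝔭^k)` has a solution `x ∈ 𝓞 F`. -/
def aExp (F : Type*) [Field F] (ℓ : ℕ) (α : 𝓞 F) (𝔭 : Ideal (𝓞 F)) : ℕ :=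
  sSup {k : ℕ | ∃ x : 𝓞 F, x ^ ℓ - α ∈ 𝔭 ^ k}

end RelBogomolov

namespace RelBogomolov

section Heights

variable {F E : Type*} [Field F] [NumberField F] [Field E] [NumberField E]

theorem sum_mult_mul_eq_sum_embeddings (g : InfinitePlace E → ℝ) :
    ∑ w : InfinitePlace E, (w.mult : ℝ) * g w = ∑ φ : E →+* ℂ, g (InfinitePlace.mk φ) := by
  rw [← Finset.sum_fiberwise Finset.univ (fun φ : E →+* ℂ => InfinitePlace.mk φ)]
  refine Finset.sum_congr rfl fun w _ => ?_
  rw [Finset.sum_congr rfl (g := fun _ => g w)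
    (fun φ hφ => by rw [(Finset.mem_filter.mp hφ).2]), Finset.sum_const, nsmul_eq_mul,
    ← InfinitePlace.card_filter_mk_eq w]

theorem sum_embeddings_restrict [Algebra F E] (g : (F →+* ℂ) → ℝ) :
    ∑ φ : E →+* ℂ, g (φ.comp (algebraMap F E)) =
      Module.finrank F E * ∑ ψ : F →+* ℂ, g ψ := by
  have hfib (ψ : F →+* ℂ) :
      (Finset.univ.filter fun φ : E →+* ℂ => φ.comp (algebraMap F E) = ψ).card =
        Module.finrank F E := by
    let : Algebra F ℂ := ψ.toAlgebra
    rw [← AlgHom.card F E ℂ, ← Fintype.card_subtype]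
    exact Fintype.card_congr
      { toFun := fun φ => { φ.1 with commutes' := fun r => RingHom.congr_fun φ.2 r }
        invFun := fun φ => ⟨φ.toRingHom, RingHom.ext fun r => φ.commutes r⟩
        left_inv := fun _ => rfl
        right_inv := fun _ => rfl }
  rw [← Finset.sum_fiberwise Finset.univ (fun φ : E →+* ℂ => φ.comp (algebraMap F E)),
    Finset.mul_sum]
  refine Finset.sum_congr rfl fun ψ _ => ?_
  rw [Finset.sum_congr rfl (g := fun _ => g ψ)
    (fun φ hφ => by rw [(Finset.mem_filter.mp hφ).2]), Finset.sum_const, nsmul_eq_mul, hfib]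

theorem mem_denomIdeal {K : Type*} [Field K] {x : K} {a : 𝓞 K} :
    a ∈ denomIdeal K x ↔ IsIntegral ℤ ((a : K) * x) := Iff.rfl

theorem exists_denomIdeal_add_mul_eq_one (x : F) :
    ∃ a ∈ denomIdeal F x, ∃ b ∈ denomIdeal F x, (a : F) + b * x = 1 := by
  let J : FractionalIdeal (nonZeroDivisors (𝓞 F)) F :=
    1 + FractionalIdeal.spanSingleton (nonZeroDivisors (𝓞 F)) x
  have h1 : (1 : F) ∈ J := by
    have : (1 : FractionalIdeal (nonZeroDivisors (𝓞 F)) F) ≤ J := le_self_add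
    exact this (FractionalIdeal.one_mem_one _)
  have hx : x ∈ J := by
    have : FractionalIdeal.spanSingleton (nonZeroDivisors (𝓞 F)) x ≤ J := le_add_self
    exact this (FractionalIdeal.mem_spanSingleton_self _ x)
  have hJ : J ≠ 0 := fun h => by
    rw [h, FractionalIdeal.mem_zero_iff] at h1
    exact one_ne_zero h1
  have key {y : F} (hy : y ∈ J⁻¹) : ∃ a ∈ denomIdeal F x, (a : F) = y := by
    rw [FractionalIdeal.mem_inv_iff hJ] at hy
    obtain ⟨a, ha⟩ := (FractionalIdeal.mem_one_iff _).mp (hy 1 h1)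
    obtain ⟨b, hb⟩ := (FractionalIdeal.mem_one_iff _).mp (hy x hx)
    rw [mul_one] at ha
    refine ⟨a, ?_, ha⟩
    rw [mem_denomIdeal]
    have : (a : F) * x = (b : F) := by
      rw [show (a : F) = y from ha]; exact hb.symm
    rw [this]
    exact RingOfIntegers.isIntegral_coe b
  have hone : (1 : F) ∈ J⁻¹ + J⁻¹ * FractionalIdeal.spanSingleton (nonZeroDivisors (𝓞 F)) x := by
    have : J⁻¹ + J⁻¹ * FractionalIdeal.spanSingleton (nonZeroDivisors (𝓞 F)) x = 1 := by
      rw [← mul_one_add, inv_mul_cancel₀ hJ]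
    rw [this]
    exact FractionalIdeal.one_mem_one _
  obtain ⟨u, hu, v, hv, huv⟩ := (FractionalIdeal.mem_add _ _ _).mp hone
  rw [mul_comm, FractionalIdeal.mem_singleton_mul] at hv
  obtain ⟨v, hv, rfl⟩ := hv
  obtain ⟨a, ha, rfl⟩ := key hu
  obtain ⟨b, hb, rfl⟩ := key hv
  exact ⟨a, ha, b, hb, by rw [mul_comm (b : F)]; exact huv⟩

theorem denomIdeal_algebraMap [Algebra F E] (x : F) :
    denomIdeal E (algebraMap F E x) = (denomIdeal F x).map (algebraMap (𝓞 F) (𝓞 E)) := by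
  apply le_antisymm
  · intro c hc
    obtain ⟨a, ha, b, hb, hab⟩ := exists_denomIdeal_add_mul_eq_one x
    obtain ⟨d, hd⟩ : ∃ d : 𝓞 E, (d : E) = (c : E) * algebraMap F E x :=
      ⟨⟨_, mem_denomIdeal.mp hc⟩, rfl⟩
    have : c = c * algebraMap (𝓞 F) (𝓞 E) a + d * algebraMap (𝓞 F) (𝓞 E) b := by
      apply RingOfIntegers.ext
      have h := congrArg (algebraMap F E) hab
      simp only [map_add, map_mul, map_one] at h
      have e (z : 𝓞 F) : ((algebraMap (𝓞 F) (𝓞 E) z : 𝓞 E) : E) = algebraMap F E (z : F) := rfl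
      simp only [map_add, map_mul, hd, e]
      linear_combination -(c : E) * h
    rw [this]
    exact Ideal.add_mem _ (Ideal.mul_mem_left _ _ (Ideal.mem_map_of_mem _ ha))
      (Ideal.mul_mem_left _ _ (Ideal.mem_map_of_mem _ hb))
  · rw [Ideal.map_le_iff_le_comap]
    intro a ha
    have := IsIntegral.algebraMap (B := E) (mem_denomIdeal.mp ha)
    rw [map_mul] at this
    exact this

theorem exists_natCast_mem_denomIdeal (x : F) : ∃ k : ℕ, k ≠ 0 ∧ (k : 𝓞 F) ∈ denomIdeal F x := by
  have hx : IsAlgebraic ℤ x :=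
    (IsFractionRing.isAlgebraic_iff ℤ ℚ F).mpr (Algebra.IsAlgebraic.isAlgebraic x)
  obtain ⟨k, hk, h⟩ := hx.exists_integral_multiple
  refine ⟨k.natAbs, Int.natAbs_ne_zero.mpr hk, ?_⟩
  rw [mem_denomIdeal]
  have hcast : ((k.natAbs : 𝓞 F) : F) * x = ((k.natAbs : ℤ) : F) * x := by simp
  rw [hcast]
  rw [zsmul_eq_mul] at h
  rcases Int.natAbs_eq k with hk' | hk'
  · rwa [← hk']
  · rw [show ((k.natAbs : ℤ)) = -k by omega, Int.cast_neg, neg_mul]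
    exact h.neg

theorem denomIdeal_ne_bot (x : F) : denomIdeal F x ≠ ⊥ := by
  obtain ⟨k, hk, h⟩ := exists_natCast_mem_denomIdeal x
  intro hbot
  rw [hbot, Ideal.mem_bot] at h
  exact hk (by exact_mod_cast h)

theorem finrank_mul_nfHeight (x : E) :
    Module.finrank ℚ E * nfHeight E x =
      ∑ φ : E →+* ℂ, Real.log (max 1 ‖φ x‖) + Real.log (Ideal.absNorm (denomIdeal E x)) := by
  have h : (Module.finrank ℚ E : ℝ) ≠ 0 := by exact_mod_cast Module.finrank_pos.ne'
  rw [nfHeight, mul_inv_cancel_left₀ h,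
    sum_mult_mul_eq_sum_embeddings (fun w => Real.log (max 1 (w x)))]
  rfl

theorem nfHeight_algebraMap [Algebra F E] (x : F) :
    nfHeight E (algebraMap F E x) = nfHeight F x := by
  have hE : (Module.finrank ℚ E : ℝ) ≠ 0 := by exact_mod_cast Module.finrank_pos.ne'
  apply mul_left_cancel₀ hE
  have hsum := sum_embeddings_restrict (E := E) (fun ψ : F →+* ℂ => Real.log (max 1 ‖ψ x‖))
  simp only [RingHom.comp_apply] at hsum
  rw [finrank_mul_nfHeight, hsum, denomIdeal_algebraMap, Ideal.absNorm_algebraMap,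
    ← IsFractionRing.finrank_eq (𝓞 F) F (𝓞 E) E, Nat.cast_pow, Real.log_pow, ← mul_add,
    ← finrank_mul_nfHeight, ← Module.finrank_mul_finrank ℚ F E]
  push_cast
  ring

theorem nfHeight_map (f : F →+* E) (x : F) : nfHeight E (f x) = nfHeight F x :=
  letI := f.toAlgebra
  nfHeight_algebraMap x

theorem log_absNorm_span_singleton (y : 𝓞 E) :
    Real.log (Ideal.absNorm (Ideal.span {y})) = ∑ φ : E →+* ℂ, Real.log ‖φ y‖ := by
  rcases eq_or_ne y 0 with rfl | hy
  · simp
  have hy' : (y : E) ≠ 0 := by simpa using hy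
  have h := congrArg Real.log (InfinitePlace.prod_eq_abs_norm (y : E))
  rw [Real.log_prod fun w _ => pow_ne_zero _ (by simpa using hy')] at h
  simp only [Real.log_pow] at h
  rw [sum_mult_mul_eq_sum_embeddings (fun w => Real.log (w (y : E)))] at h
  rw [Ideal.absNorm_span_singleton, Nat.cast_natAbs, Int.cast_abs, Real.log_abs]
  rw [← Algebra.coe_norm_int] at h
  simp only [Rat.cast_abs, Real.log_abs, Rat.cast_intCast, InfinitePlace.apply] at h
  exact h.symm

theorem log_div_two_le_log_two_add_nfHeight {x x' : E} (hne : x ≠ x') {p : ℕ} (hp : p ≠ 0)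
    (hdvd : ∀ a ∈ denomIdeal E x, ∀ a' ∈ denomIdeal E x',
      ∀ b ∈ denomIdeal E x, ∀ b' ∈ denomIdeal E x', ∃ z : 𝓞 E,
        ((a : E) * a' * (x - x')) * (b * b' * (x - x')) = p * z) :
    Real.log p / 2 ≤ Real.log 2 + nfHeight E x + nfHeight E x' := by
  obtain ⟨k, hk, hkx⟩ := exists_natCast_mem_denomIdeal (x - x')
  obtain ⟨y, hy⟩ : ∃ y : 𝓞 E, (y : E) = (k : E) * (x - x') :=
    ⟨⟨_, mem_denomIdeal.mp hkx⟩, by simp [RingOfIntegers.map_mk]⟩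
  have hy0 : y ≠ 0 := by
    rintro rfl
    have : (k : E) * (x - x') = 0 := by rw [← hy]; simp
    rcases mul_eq_zero.mp this with h | h
    · exact hk (by exact_mod_cast h)
    · exact hne (sub_eq_zero.mp h)
  let I := denomIdeal E x * denomIdeal E x'
  have hmem : ∀ r ∈ I, ∀ s ∈ I,
      r * s * (y * y) ∈ Ideal.span {((k ^ 2 * p : ℕ) : 𝓞 E)} := by
    intro r hr
    refine Submodule.mul_induction_on hr ?_ ?_
    · intro a ha a' ha' s hs
      refine Submodule.mul_induction_on hs ?_ ?_
      · intro b hb b' hb'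
        obtain ⟨z, hz⟩ := hdvd a ha a' ha' b hb b' hb'
        rw [Ideal.mem_span_singleton]
        refine ⟨z, RingOfIntegers.ext ?_⟩
        simp only [map_mul, hy, map_natCast]
        push_cast
        linear_combination (k : E) ^ 2 * hz
      · intro s t hs ht
        rw [mul_add, add_mul]
        exact Ideal.add_mem _ hs ht
    · intro r t hr ht s hs
      rw [add_mul, add_mul]
      exact Ideal.add_mem _ (hr s hs) (ht s hs)
  have hle : I * I * Ideal.span {y * y} ≤ Ideal.span {((k ^ 2 * p : ℕ) : 𝓞 E)} := by
    rw [Ideal.mul_le]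
    intro t ht u hu
    obtain ⟨v, rfl⟩ := Ideal.mem_span_singleton'.mp hu
    rw [mul_left_comm]
    refine Ideal.mul_mem_left _ _ ?_
    refine Submodule.mul_induction_on ht hmem fun a b ha hb => ?_
    rw [add_mul]
    exact Ideal.add_mem _ ha hb
  have hnorm {a : E} : (Ideal.absNorm (denomIdeal E a) : ℝ) ≠ 0 := by
    exact_mod_cast Ideal.absNorm_eq_zero_iff.not.mpr (denomIdeal_ne_bot a)
  have hnormy : (Ideal.absNorm (Ideal.span {y}) : ℝ) ≠ 0 := by
    exact_mod_cast Ideal.absNorm_eq_zero_iff.not.mpr (by simpa using hy0)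
  have hlog : Real.log (Ideal.absNorm (Ideal.span {((k ^ 2 * p : ℕ) : 𝓞 E)})) ≤
      2 * Real.log (Ideal.absNorm (denomIdeal E x)) +
        2 * Real.log (Ideal.absNorm (denomIdeal E x')) +
        2 * Real.log (Ideal.absNorm (Ideal.span {y})) := by
    have hdvd' := Ideal.absNorm_dvd_absNorm_of_le hle
    rw [← Ideal.span_singleton_mul_span_singleton] at hdvd'
    simp only [map_mul, I] at hdvd'
    have hpos : 0 < Ideal.absNorm (Ideal.span {((k ^ 2 * p : ℕ) : 𝓞 E)}) :=
      Nat.pos_of_ne_zero (Ideal.absNorm_eq_zero_iff.not.mpr (by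
        rw [Ideal.span_singleton_eq_bot]
        exact_mod_cast mul_ne_zero (pow_ne_zero 2 hk) hp))
    have hne' : Ideal.absNorm (denomIdeal E x) * Ideal.absNorm (denomIdeal E x') *
        (Ideal.absNorm (denomIdeal E x) * Ideal.absNorm (denomIdeal E x')) *
        (Ideal.absNorm (Ideal.span {y}) * Ideal.absNorm (Ideal.span {y})) ≠ 0 := by
      have h1 := hnorm (a := x)
      have h2 := hnorm (a := x')
      norm_cast at h1 h2 hnormy
      positivity
    have := Real.log_le_log (by exact_mod_cast hpos)
      (Nat.cast_le (α := ℝ).mpr (Nat.le_of_dvd (Nat.pos_of_ne_zero hne') hdvd'))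
    refine this.trans_eq ?_
    push_cast
    have h1 := hnorm (a := x)
    have h2 := hnorm (a := x')
    rw [Real.log_mul (by positivity) (by positivity), Real.log_mul (by positivity) (by positivity),
      Real.log_mul (by positivity) (by positivity), Real.log_mul (by positivity) (by positivity)]
    ring
  have hcard : (Fintype.card (E →+* ℂ) : ℝ) = Module.finrank ℚ E := by
    exact_mod_cast Embeddings.card E ℂ
  have hk' : (k : ℝ) ≠ 0 := by exact_mod_cast hk
  have hp' : (p : ℝ) ≠ 0 := by exact_mod_cast hp
  have hleft : Real.log (Ideal.absNorm (Ideal.span {((k ^ 2 * p : ℕ) : 𝓞 E)})) =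
      Module.finrank ℚ E * (2 * Real.log k + Real.log p) := by
    rw [log_absNorm_span_singleton]
    simp only [map_natCast, Complex.norm_natCast, Finset.sum_const, Finset.card_univ,
      nsmul_eq_mul, hcard]
    push_cast
    rw [Real.log_mul (by positivity) (by positivity), Real.log_pow]
    push_cast
    ring
  have hright : Real.log (Ideal.absNorm (Ideal.span {y})) ≤
      ∑ φ : E →+* ℂ, (Real.log k + Real.log 2 + Real.log (max 1 ‖φ x‖) +
        Real.log (max 1 ‖φ x'‖)) := by
    rw [log_absNorm_span_singleton]
    refine Finset.sum_le_sum fun φ _ => ?_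
    have h1 : 0 < max 1 ‖φ x‖ := by positivity
    have h2 : 0 < max 1 ‖φ x'‖ := by positivity
    rw [← Real.log_mul hk' two_ne_zero, ← Real.log_mul (by positivity) h1.ne',
      ← Real.log_mul (by positivity) h2.ne']
    have hφy : φ y ≠ 0 := by simpa using hy0
    refine Real.log_le_log (by positivity) ?_
    rw [hy, map_mul, map_sub, map_natCast, norm_mul, Complex.norm_natCast, mul_assoc, mul_assoc]
    refine mul_le_mul_of_nonneg_left ?_ (Nat.cast_nonneg k)
    have e1 := norm_sub_le (φ x) (φ x')
    have e2 : ‖φ x‖ ≤ max 1 ‖φ x‖ := le_max_right _ _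
    have e3 : ‖φ x'‖ ≤ max 1 ‖φ x'‖ := le_max_right _ _
    have e4 : (1 : ℝ) ≤ max 1 ‖φ x‖ := le_max_left _ _
    have e5 : (1 : ℝ) ≤ max 1 ‖φ x'‖ := le_max_left _ _
    nlinarith
  simp only [Finset.sum_add_distrib, Finset.sum_const, Finset.card_univ, nsmul_eq_mul,
    hcard] at hright
  have hx := finrank_mul_nfHeight x
  have hx' := finrank_mul_nfHeight x'
  have hD : (0 : ℝ) < Module.finrank ℚ E := by exact_mod_cast Module.finrank_pos
  refine le_of_mul_le_mul_left ?_ hD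
  linarith

end Heights

section Integrality

/-- An element `y` of `M` is integral as soon as `p * y ^ 2` is. For a number field `M` and a
prime `p` this holds when `p` is unramified in `M`. -/
def IntegralOfMulSq (p : ℕ) (M : IntermediateField ℚ ℂ) : Prop :=
  ∀ y ∈ M, IsIntegral ℤ ((p : ℂ) * y ^ 2) → IsIntegral ℤ y

theorem isIntegral_natCast_mul {R : Type*} [CommRing R] (n : ℕ) {y : R} (hy : IsIntegral ℤ y) :
    IsIntegral ℤ ((n : R) * y) := by
  simpa using hy.smul (n : ℤ)

theorem isIntegral_of_coprime_mul {R : Type*} [CommRing R] {m n : ℕ} (h : m.Coprime n) {y : R}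
    (hm : IsIntegral ℤ ((m : R) * y)) (hn : IsIntegral ℤ ((n : R) * y)) : IsIntegral ℤ y := by
  have hb := congrArg (Int.cast (R := R)) (Nat.gcd_eq_gcd_ab m n)
  rw [h.gcd_eq_one] at hb
  push_cast at hb
  have : y = (m.gcdA n) • ((m : R) * y) + (m.gcdB n) • ((n : R) * y) := by
    rw [zsmul_eq_mul, zsmul_eq_mul]
    linear_combination y * hb
  rw [this]
  exact (hm.smul _).add (hn.smul _)

theorem isIntegral_natCast_mul_of_sq {R : Type*} [CommRing R] {p : ℕ} {y : R}
    (h : IsIntegral ℤ ((p : R) * y ^ 2)) : IsIntegral ℤ ((p : R) * y) := by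
  refine IsIntegral.of_pow two_pos ?_
  rw [show ((p : R) * y) ^ 2 = p * (p * y ^ 2) by ring]
  exact isIntegral_natCast_mul p h

theorem isIntegral_natCast_mul_mul {R : Type*} [CommRing R] {p : ℕ} {y z : R}
    (hy : IsIntegral ℤ ((p : R) * y ^ 2)) (hz : IsIntegral ℤ ((p : R) * z ^ 2)) :
    IsIntegral ℤ ((p : R) * (y * z)) := by
  refine IsIntegral.of_pow two_pos ?_
  rw [show ((p : R) * (y * z)) ^ 2 = (p * y ^ 2) * (p * z ^ 2) by ring]
  exact hy.mul hz

theorem isIntegral_natCast_mul_sum_sq {R ι : Type*} [CommRing R] {p : ℕ} (s : Finset ι)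
    {y : ι → R} (hy : ∀ i ∈ s, IsIntegral ℤ ((p : R) * y i ^ 2)) :
    IsIntegral ℤ ((p : R) * (∑ i ∈ s, y i) ^ 2) := by
  rw [sq, Finset.sum_mul_sum, Finset.mul_sum]
  refine IsIntegral.sum _ fun i hi => ?_
  rw [Finset.mul_sum]
  exact IsIntegral.sum _ fun j hj => isIntegral_natCast_mul_mul (hy i hi) (hy j hj)

theorem isInt_of_prime_mul_sq {p : ℕ} (hp : p.Prime) {q : ℚ}
    (h : IsIntegral ℤ ((p : ℚ) * q ^ 2)) : ∃ z : ℤ, (z : ℚ) = q := by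
  obtain ⟨w, hw⟩ := IsIntegrallyClosed.isIntegral_iff.mp (isIntegral_natCast_mul_of_sq h)
  obtain ⟨v, hv⟩ := IsIntegrallyClosed.isIntegral_iff.mp h
  simp only [eq_intCast] at hw hv
  have hpw : (w : ℚ) ^ 2 = p * v := by rw [hw, hv]; ring
  have hdvd : (p : ℤ) ∣ w ^ 2 := ⟨v, by exact_mod_cast hpw⟩
  obtain ⟨z, rfl⟩ := (Nat.prime_iff_prime_int.mp hp).dvd_of_dvd_pow hdvd
  refine ⟨z, ?_⟩
  have hp0 : (p : ℚ) ≠ 0 := by exact_mod_cast hp.ne_zero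
  apply mul_left_cancel₀ hp0
  rw [← hw]
  push_cast
  rfl

theorem exists_eq_add_mul_of_mem_sup {M : IntermediateField ℚ ℂ} {s : ℂ} (hs : s ^ 2 ∈ M) {y : ℂ}
    (hy : y ∈ M ⊔ ℚ⟮s⟯) : ∃ a ∈ M, ∃ b ∈ M, y = a + b * s := by
  have halg : IsAlgebraic M s := by
    refine IsIntegral.isAlgebraic (IsIntegral.of_pow two_pos ?_)
    exact isIntegral_algebraMap (x := (⟨s ^ 2, hs⟩ : M))
  rw [← restrictScalars_adjoin_eq_sup, mem_restrictScalars, ← mem_toSubalgebra,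
    adjoin_toSubalgebra_of_isAlgebraic (by simpa using halg)] at hy
  induction hy using Algebra.adjoin_induction with
  | mem x hx => exact ⟨0, zero_mem _, 1, one_mem _, by simpa using hx⟩
  | algebraMap r => exact ⟨r, r.2, 0, zero_mem _, by simp⟩
  | add x y _ _ hx hy =>
    obtain ⟨a, ha, b, hb, rfl⟩ := hx
    obtain ⟨c, hc, d, hd, rfl⟩ := hy
    exact ⟨a + c, add_mem ha hc, b + d, add_mem hb hd, by ring⟩
  | mul x y _ _ hx hy =>
    obtain ⟨a, ha, b, hb, rfl⟩ := hx
    obtain ⟨c, hc, d, hd, rfl⟩ := hy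
    exact ⟨a * c + b * d * s ^ 2, add_mem (mul_mem ha hc) (mul_mem (mul_mem hb hd) hs),
      a * d + b * c, add_mem (mul_mem ha hd) (mul_mem hb hc), by ring⟩

theorem aeval_conj_eq_zero {M : IntermediateField ℚ ℂ} {s a b : ℂ} (hs : s ^ 2 ∈ M) (hsM : s ∉ M)
    (ha : a ∈ M) (hb : b ∈ M) {f : Polynomial ℚ} (hf : Polynomial.aeval (a + b * s) f = 0) :
    Polynomial.aeval (a - b * s) f = 0 := by
  have key : ∃ c ∈ M, ∃ d ∈ M, Polynomial.aeval (a + b * s) f = c + d * s ∧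
      Polynomial.aeval (a - b * s) f = c - d * s := by
    clear hf
    induction f using Polynomial.induction_on with
    | C r => exact ⟨algebraMap ℚ ℂ r, M.algebraMap_mem r, 0, zero_mem _, by simp, by simp⟩
    | add f g hf hg =>
      obtain ⟨c, hc, d, hd, h1, h2⟩ := hf
      obtain ⟨c', hc', d', hd', h1', h2'⟩ := hg
      exact ⟨c + c', add_mem hc hc', d + d', add_mem hd hd', by rw [map_add, h1, h1']; ring,
        by rw [map_add, h2, h2']; ring⟩
    | monomial n r h =>
      obtain ⟨c, hc, d, hd, h1, h2⟩ := h
      refine ⟨c * a + d * b * s ^ 2, add_mem (mul_mem hc ha) (mul_mem (mul_mem hd hb) hs),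
        c * b + d * a, add_mem (mul_mem hc hb) (mul_mem hd ha), ?_, ?_⟩
      · rw [pow_succ, ← mul_assoc, map_mul, h1, Polynomial.aeval_X]; ring
      · rw [pow_succ, ← mul_assoc, map_mul, h2, Polynomial.aeval_X]; ring
  obtain ⟨c, hc, d, hd, h1, h2⟩ := key
  rw [hf] at h1
  have hd0 : d = 0 := by
    by_contra hd0
    apply hsM
    have : s = -c / d := by
      rw [eq_div_iff hd0]
      linear_combination -h1
    rw [this]
    exact div_mem (neg_mem hc) hd
  rw [h2]
  rw [hd0] at h1 ⊢
  linear_combination -h1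

theorem isIntegral_conj {M : IntermediateField ℚ ℂ} {s a b : ℂ} (hs : s ^ 2 ∈ M) (hsM : s ∉ M)
    (ha : a ∈ M) (hb : b ∈ M) (h : IsIntegral ℤ (a + b * s)) : IsIntegral ℤ (a - b * s) := by
  obtain ⟨f, hf, h0⟩ := h
  refine ⟨f, hf, ?_⟩
  have := aeval_conj_eq_zero (f := f.map (Int.castRingHom ℚ)) hs hsM ha hb
    (by rwa [← algebraMap_int_eq, Polynomial.aeval_map_algebraMap])
  rwa [← algebraMap_int_eq, Polynomial.aeval_map_algebraMap] at this

theorem IntegralOfMulSq.sup_adjoin_sqrt {p q : ℕ} {M : IntermediateField ℚ ℂ}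
    (hM : IntegralOfMulSq p M) (hpq : p.Coprime (2 * q)) {s : ℂ} (hs : s ^ 2 = q) :
    IntegralOfMulSq p (M ⊔ ℚ⟮s⟯) := by
  by_cases hsM : s ∈ M
  · rwa [sup_eq_left.mpr (adjoin_simple_le_iff.mpr hsM)]
  have hs' : s ^ 2 ∈ M := by rw [hs]; exact _root_.natCast_mem M q
  intro y hy hint
  obtain ⟨a, ha, b, hb, rfl⟩ := exists_eq_add_mul_of_mem_sup hs' hy
  have hconj : IsIntegral ℤ ((p : ℂ) * (a - b * s) ^ 2) := by
    have hp := _root_.natCast_mem M p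
    have := isIntegral_conj (a := p * (a ^ 2 + b ^ 2 * s ^ 2)) (b := p * (2 * a * b)) hs' hsM
      (mul_mem hp (add_mem (pow_mem ha 2) (mul_mem (pow_mem hb 2) hs')))
      (mul_mem hp (mul_mem (mul_mem (ofNat_mem M 2) ha) hb))
      (by convert hint using 1; ring)
    convert this using 1
    ring
  have hprod := isIntegral_natCast_mul_mul hint hconj
  have h2a : IsIntegral ℤ (2 * a) := by
    refine hM _ (mul_mem (ofNat_mem M 2) ha) ?_
    rw [show (p : ℂ) * (2 * a) ^ 2 = p * (a + b * s) ^ 2 + p * (a - b * s) ^ 2 +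
      (2 : ℕ) * (p * ((a + b * s) * (a - b * s))) by push_cast; ring]
    exact (hint.add hconj).add (isIntegral_natCast_mul 2 hprod)
  have h2b : IsIntegral ℤ (2 * b * q) := by
    refine hM _ (mul_mem (mul_mem (ofNat_mem M 2) hb) (_root_.natCast_mem M q)) ?_
    rw [show (p : ℂ) * (2 * b * q) ^ 2 = q * (p * (a + b * s) ^ 2 + p * (a - b * s) ^ 2 -
      (2 : ℕ) * (p * ((a + b * s) * (a - b * s)))) by
        push_cast; linear_combination (-4 * p * q * b ^ 2) * hs]
    exact isIntegral_natCast_mul q ((hint.add hconj).sub (isIntegral_natCast_mul 2 hprod))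
  have hsint : IsIntegral ℤ s := by
    refine IsIntegral.of_pow two_pos ?_
    rw [hs]
    exact_mod_cast isIntegral_algebraMap (R := ℤ) (A := ℂ) (x := (q : ℤ))
  refine isIntegral_of_coprime_mul hpq (isIntegral_natCast_mul_of_sq hint) ?_
  rw [show ((2 * q : ℕ) : ℂ) * (a + b * s) = q * (2 * a) + 2 * b * q * s by push_cast; ring]
  exact (isIntegral_natCast_mul q h2a).add (h2b.mul hsint)

theorem integralOfMulSq_iSup {p : ℕ} {M : ℕ → IntermediateField ℚ ℂ} (hmono : Monotone M)
    (h : ∀ n, IntegralOfMulSq p (M n)) : IntegralOfMulSq p (⨆ n, M n) := by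
  intro y hy
  rw [← SetLike.mem_coe, coe_iSup_of_directed hmono.directed_le, Set.mem_iUnion] at hy
  obtain ⟨n, hn⟩ := hy
  exact h n y hn

theorem minpoly_gen_of_pow_eq_three {θ : ℂ} {m : ℕ} (hθ : θ ^ 3 ^ m = 3) :
    minpoly ℚ (AdjoinSimple.gen ℚ θ) = Polynomial.X ^ 3 ^ m - Polynomial.C 3 := by
  have hirr : Irreducible (Polynomial.X ^ 3 ^ m - Polynomial.C (3 : ℚ)) := by
    refine X_pow_sub_C_irreducible_of_prime_pow Nat.prime_three (by norm_num) m fun b hb => ?_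
    have hint : IsIntegral ℤ b := by
      refine IsIntegral.of_pow three_pos ?_
      rw [hb]
      exact_mod_cast isIntegral_algebraMap (R := ℤ) (A := ℚ) (x := 3)
    obtain ⟨z, rfl⟩ := IsIntegrallyClosed.isIntegral_iff.mp hint
    simp only [eq_intCast] at hb
    have hz : z ^ 3 = 3 := by exact_mod_cast hb
    have h1 : 1 < z := by nlinarith [sq_nonneg z, sq_nonneg (z + 1)]
    nlinarith [sq_nonneg z, sq_nonneg (z - 1)]
  refine (minpoly.eq_of_irreducible_of_monic hirr ?_
    (Polynomial.monic_X_pow_sub_C _ (by positivity))).symm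
  rw [map_sub, map_pow, Polynomial.aeval_X, Polynomial.aeval_C, sub_eq_zero]
  apply (algebraMap ℚ⟮θ⟯ ℂ).injective
  rw [map_pow, map_ofNat, map_ofNat]
  exact hθ

theorem integralOfMulSq_adjoin_root_three {p : ℕ} (hp : p.Prime) (hp3 : p ≠ 3) {θ : ℂ} {m : ℕ}
    (hθ : θ ^ 3 ^ m = 3) : IntegralOfMulSq p ℚ⟮θ⟯ := by
  have hint3 : IsIntegral ℤ (3 : ℂ) := by
    exact_mod_cast isIntegral_algebraMap (R := ℤ) (A := ℂ) (x := 3)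
  have hθint : IsIntegral ℤ θ := by
    refine IsIntegral.of_pow (n := 3 ^ m) (by positivity) ?_
    rwa [hθ]
  have : FiniteDimensional ℚ ℚ⟮θ⟯ := adjoin.finiteDimensional hθint.tower_top
  have hgen : IsIntegral ℤ (AdjoinSimple.gen ℚ θ) :=
    (isIntegral_algebraMap_iff (algebraMap ℚ⟮θ⟯ ℂ).injective).mp hθint
  intro y hy hyint
  obtain ⟨Y, rfl⟩ : ∃ Y : ℚ⟮θ⟯, (Y : ℂ) = y := ⟨⟨y, hy⟩, rfl⟩
  have hY : IsIntegral ℤ ((p : ℚ⟮θ⟯) * Y ^ 2) :=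
    (isIntegral_algebraMap_iff (algebraMap ℚ⟮θ⟯ ℂ).injective).mp (by simpa using hyint)
  have hint_adjoin : ∀ w ∈ Algebra.adjoin ℤ {AdjoinSimple.gen ℚ θ}, IsIntegral ℤ w := fun w hw =>
    Algebra.adjoin_le (S := integralClosure ℤ ℚ⟮θ⟯) (Set.singleton_subset_iff.mpr hgen) hw
  have hdual : Y ∈ (Algebra.traceForm ℚ ℚ⟮θ⟯).dualSubmodule
      (Subalgebra.toSubmodule (Algebra.adjoin ℤ {AdjoinSimple.gen ℚ θ})) := by
    rw [LinearMap.BilinForm.mem_dualSubmodule]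
    intro w hw
    have hwint : IsIntegral ℤ w := hint_adjoin w hw
    rw [Algebra.traceForm_apply]
    have htr : IsIntegral ℤ ((p : ℚ) * (Algebra.trace ℚ ℚ⟮θ⟯ (Y * w)) ^ 2) := by
      rw [← isIntegral_algebraMap_iff (B := ℂ) (algebraMap ℚ ℂ).injective, map_mul, map_pow,
        map_natCast, trace_eq_sum_embeddings]
      refine isIntegral_natCast_mul_sum_sq _ fun φ _ => ?_
      have := (hY.mul (hwint.pow 2)).map φ
      rw [map_mul, map_mul, map_pow, map_pow, map_natCast] at this
      rw [map_mul, mul_pow, ← mul_assoc]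
      exact this
    obtain ⟨z, hz⟩ := isInt_of_prime_mul_sq hp htr
    exact Submodule.mem_one.mpr ⟨z, by simpa using hz⟩
  have htop : Algebra.adjoin ℚ {AdjoinSimple.gen ℚ θ} = ⊤ := by
    have := (adjoin.powerBasis (hθint.tower_top (A := ℚ))).adjoin_gen_eq_top
    rwa [adjoin.powerBasis_gen] at this
  rw [traceForm_dualSubmodule_adjoin ℤ ℚ htop hgen, minpoly_gen_of_pow_eq_three hθ] at hdual
  have hder : Polynomial.aeval (AdjoinSimple.gen ℚ θ)
      (Polynomial.derivative (Polynomial.X ^ 3 ^ m - Polynomial.C (3 : ℚ))) =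
        ((3 ^ m : ℕ) : ℚ⟮θ⟯) * AdjoinSimple.gen ℚ θ ^ (3 ^ m - 1) := by
    rw [Polynomial.derivative_sub, Polynomial.derivative_C, Polynomial.derivative_X_pow, sub_zero,
      map_mul, map_pow, Polynomial.aeval_X, Polynomial.aeval_C, map_natCast]
  rw [hder] at hdual
  obtain ⟨w, hw, hwY⟩ := hdual
  replace hwY : (((3 ^ m : ℕ) : ℚ⟮θ⟯) * AdjoinSimple.gen ℚ θ ^ (3 ^ m - 1))⁻¹ * w = Y := hwY
  have hpow : AdjoinSimple.gen ℚ θ ^ (3 ^ m - 1) * AdjoinSimple.gen ℚ θ = 3 := by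
    rw [← pow_succ, Nat.sub_add_cancel (Nat.one_le_pow _ _ three_pos)]
    apply (algebraMap ℚ⟮θ⟯ ℂ).injective
    rw [map_pow, map_ofNat]
    exact hθ
  have hgen0 : AdjoinSimple.gen ℚ θ ≠ 0 := fun h => by
    rw [h, mul_zero] at hpow
    exact three_ne_zero hpow.symm
  have hwint : IsIntegral ℤ w := hint_adjoin w hw
  have h3Y : ((3 ^ (m + 1) : ℕ) : ℚ⟮θ⟯) * Y = w * AdjoinSimple.gen ℚ θ := by
    rw [← hwY, pow_succ, Nat.cast_mul, Nat.cast_ofNat, ← hpow]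
    have h3 : ((3 ^ m : ℕ) : ℚ⟮θ⟯) ≠ 0 := Nat.cast_ne_zero.mpr (by positivity)
    field_simp
  have hcop : p.Coprime (3 ^ (m + 1)) :=
    ((Nat.coprime_primes hp Nat.prime_three).mpr hp3).pow_right _
  refine (isIntegral_algebraMap_iff (algebraMap ℚ⟮θ⟯ ℂ).injective).mpr
    (isIntegral_of_coprime_mul hcop (isIntegral_natCast_mul_of_sq hY) ?_)
  rw [h3Y]
  exact hwint.mul hgen

end Integrality

section QuadraticStep

theorem algHeight_eq {x : ℂ} (hx : IsIntegral ℚ x) [NumberField ℚ⟮x⟯] :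
    algHeight x = nfHeight ℚ⟮x⟯ (AdjoinSimple.gen ℚ x) := by
  rw [algHeight, dif_pos hx]

theorem IntegralOfMulSq.sqrt_notMem {p : ℕ} (hp : p.Prime) {M : IntermediateField ℚ ℂ}
    (hM : IntegralOfMulSq p M) {s : ℂ} (hs : s ^ 2 = p) : s ∉ M := by
  intro hsM
  have hp0 : (p : ℂ) ≠ 0 := by exact_mod_cast hp.ne_zero
  have hint : IsIntegral ℤ s⁻¹ := by
    refine hM _ (inv_mem hsM) ?_
    rw [inv_pow, hs, mul_inv_cancel₀ hp0]
    exact isIntegral_one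
  have hint' : IsIntegral ℤ (p : ℚ)⁻¹ := by
    rw [← isIntegral_algebraMap_iff (B := ℂ) (algebraMap ℚ ℂ).injective, map_inv₀, map_natCast,
      ← hs, ← inv_pow]
    exact hint.pow 2
  obtain ⟨z, hz⟩ := IsIntegrallyClosed.isIntegral_iff.mp hint'
  have hpQ : (p : ℚ) ≠ 0 := by exact_mod_cast hp.ne_zero
  rw [eq_intCast, ← mul_eq_one_iff_eq_inv₀ hpQ] at hz
  have : (p : ℤ) ∣ 1 := ⟨z, by rw [mul_comm]; exact_mod_cast hz.symm⟩
  exact hp.one_lt.ne' (by exact_mod_cast Int.eq_one_of_dvd_one (by positivity) this)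

theorem IntegralOfMulSq.isIntegral_two_mul {p : ℕ} {M : IntermediateField ℚ ℂ}
    (hM : IntegralOfMulSq p M) {s : ℂ} (hs : s ^ 2 = p) (hsM : s ∉ M) {c d : ℂ} (hc : c ∈ M)
    (hd : d ∈ M) (h : IsIntegral ℤ (c + d * s)) : IsIntegral ℤ (2 * d) := by
  have hs' : s ^ 2 ∈ M := by rw [hs]; exact _root_.natCast_mem M p
  refine hM _ (mul_mem (ofNat_mem M 2) hd) ?_
  rw [show (p : ℂ) * (2 * d) ^ 2 = ((c + d * s) - (c - d * s)) ^ 2 by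
    linear_combination (-4 * d ^ 2) * hs]
  exact (h.sub (isIntegral_conj hs' hsM hc hd h)).pow 2

/-- The difference of two conjugates, cleared of its denominators, is divisible by the square root
of `p` among the algebraic integers. -/
theorem IntegralOfMulSq.exists_eq_mul_sqrt {p : ℕ} {M : IntermediateField ℚ ℂ}
    (hM : IntegralOfMulSq p M) {s : ℂ} (hs : s ^ 2 = p) (hsM : s ∉ M) {a b : ℂ} (ha : a ∈ M)
    (hb : b ∈ M) {α α' : ℂ} (hα : IsIntegral ℤ α) (hα' : IsIntegral ℤ α')
    (hα'M : α' ∈ M ⊔ ℚ⟮s⟯) (h : IsIntegral ℤ (α * (a + b * s)))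
    (h' : IsIntegral ℤ (α' * (a - b * s))) :
    ∃ t : ℂ, IsIntegral ℤ t ∧ α * α' * ((a + b * s) - (a - b * s)) = t * s := by
  have hs' : s ^ 2 ∈ M := by rw [hs]; exact _root_.natCast_mem M p
  obtain ⟨e, he, f, hf, rfl⟩ := exists_eq_add_mul_of_mem_sup hs' hα'M
  have h2f := hM.isIntegral_two_mul hs hsM he hf hα'
  have h2w : IsIntegral ℤ (2 * (f * a - e * b)) := by
    refine hM.isIntegral_two_mul hs hsM (c := e * a - f * b * s ^ 2)
      (sub_mem (mul_mem he ha) (mul_mem (mul_mem hf hb) hs'))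
      (sub_mem (mul_mem hf ha) (mul_mem he hb)) ?_
    convert h' using 1
    ring
  exact ⟨α * (a + b * s) * (2 * f) - α * (2 * (f * a - e * b)), (h.mul h2f).sub (hα.mul h2w),
    by ring⟩

theorem IntegralOfMulSq.log_le_algHeight {p : ℕ} (hp : p.Prime) {M : IntermediateField ℚ ℂ}
    (hM : IntegralOfMulSq p M) (halg : ∀ x ∈ M, IsIntegral ℚ x) {s : ℂ} (hs : s ^ 2 = p) {γ : ℂ}
    (hγ : γ ∈ M ⊔ ℚ⟮s⟯) (hγM : γ ∉ M) : Real.log (p / 4) / 4 ≤ algHeight γ := by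
  have hsM := hM.sqrt_notMem hp hs
  have hs' : s ^ 2 ∈ M := by rw [hs]; exact _root_.natCast_mem M p
  have hsint : IsIntegral ℚ s := IsIntegral.of_pow two_pos (halg _ hs')
  have hp0 : (p : ℂ) ≠ 0 := by exact_mod_cast hp.ne_zero
  have hs0 : s ≠ 0 := fun h => hsM (h ▸ zero_mem M)
  obtain ⟨a, ha, b, hb, rfl⟩ := exists_eq_add_mul_of_mem_sup hs' hγ
  have hb0 : b ≠ 0 := by
    rintro rfl
    exact hγM (by simpa using ha)
  set γ := a + b * s
  set γ' := a - b * s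
  have hγint : IsIntegral ℚ γ := (halg a ha).add ((halg b hb).mul hsint)
  have hγ'int : IsIntegral ℚ γ' := (halg a ha).sub ((halg b hb).mul hsint)
  have hMle : M ≤ M ⊔ ℚ⟮s⟯ := le_sup_left
  have hsN : s ∈ M ⊔ ℚ⟮s⟯ := le_sup_right (a := M) (mem_adjoin_simple_self ℚ s)
  have hγ' : γ' ∈ M ⊔ ℚ⟮s⟯ := sub_mem (hMle ha) (mul_mem (hMle hb) hsN)
  let E : IntermediateField ℚ ℂ := ℚ⟮γ⟯ ⊔ ℚ⟮γ'⟯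
  have hEN : E ≤ M ⊔ ℚ⟮s⟯ :=
    sup_le (adjoin_simple_le_iff.mpr hγ) (adjoin_simple_le_iff.mpr hγ')
  have hfin : FiniteDimensional ℚ ℚ⟮γ⟯ := adjoin.finiteDimensional hγint
  have hfin' : FiniteDimensional ℚ ℚ⟮γ'⟯ := adjoin.finiteDimensional hγ'int
  have : NumberField ℚ⟮γ⟯ := ⟨⟩
  have : FiniteDimensional ℚ E := finiteDimensional_sup _ _
  have : NumberField E := ⟨⟩
  let x : E := ⟨γ, le_sup_left (a := ℚ⟮γ⟯) (mem_adjoin_simple_self ℚ γ)⟩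
  let x' : E := ⟨γ', le_sup_right (a := ℚ⟮γ⟯) (mem_adjoin_simple_self ℚ γ')⟩
  have hx : nfHeight E x = algHeight γ := by
    rw [algHeight_eq hγint]
    exact nfHeight_map (inclusion (le_sup_left : ℚ⟮γ⟯ ≤ E)).toRingHom (AdjoinSimple.gen ℚ γ)
  have hx' : nfHeight E x' = algHeight γ := by
    have hroot : Polynomial.aeval x' (minpoly ℚ γ) = 0 := by
      apply (algebraMap E ℂ).injective
      rw [← Polynomial.aeval_algebraMap_apply, map_zero]
      exact aeval_conj_eq_zero hs' hsM ha hb (minpoly.aeval ℚ γ)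
    let f : ℚ⟮γ⟯ →ₐ[ℚ] E := (algHomAdjoinIntegralEquiv ℚ hγint).symm
      ⟨x', Polynomial.mem_aroots.mpr ⟨minpoly.ne_zero hγint, hroot⟩⟩
    have hf : f (AdjoinSimple.gen ℚ γ) = x' :=
      algHomAdjoinIntegralEquiv_symm_apply_gen ℚ hγint _
    rw [algHeight_eq hγint, ← nfHeight_map f.toRingHom]
    exact congrArg _ hf.symm
  have hne : x ≠ x' := by
    intro h
    have h2 : a + b * s = a - b * s := congrArg Subtype.val h
    have : 2 * (b * s) = 0 := by linear_combination h2
    simp [hb0, hs0] at this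
  have hint {y : E} : IsIntegral ℤ (y : ℂ) ↔ IsIntegral ℤ y :=
    isIntegral_algebraMap_iff (algebraMap E ℂ).injective
  have hdvd (α : 𝓞 E) (hα : α ∈ denomIdeal E x) (α' : 𝓞 E) (hα' : α' ∈ denomIdeal E x') :
      ∃ t : ℂ, IsIntegral ℤ t ∧ (((α : E) * α' * (x - x') : E) : ℂ) = t * s := by
    exact hM.exists_eq_mul_sqrt hs hsM ha hb
      (hint.mpr (RingOfIntegers.isIntegral_coe α)) (hint.mpr (RingOfIntegers.isIntegral_coe α'))
      (hEN (α' : E).2) (hint.mpr (mem_denomIdeal.mp hα)) (hint.mpr (mem_denomIdeal.mp hα'))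
  have key := log_div_two_le_log_two_add_nfHeight hne hp.ne_zero (by
    intro α hα α' hα' β hβ β' hβ'
    obtain ⟨t, ht, hαt⟩ := hdvd α hα α' hα'
    obtain ⟨u, hu, hβu⟩ := hdvd β hβ β' hβ'
    let z : E := ((α : E) * α' * (x - x')) * (β * β' * (x - x')) / p
    have hz : (z : ℂ) = t * u := by
      have : (z : ℂ) = (((α : E) * α' * (x - x') : E) : ℂ) * ((β * β' * (x - x') : E) : ℂ) / p :=
        rfl
      rw [this, hαt, hβu, div_eq_iff hp0]
      linear_combination t * u * hs
    have hzint : IsIntegral ℤ z := hint.mp (hz ▸ ht.mul hu)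
    refine ⟨⟨z, hzint⟩, ?_⟩
    have hpE : (p : E) ≠ 0 := by exact_mod_cast hp.ne_zero
    exact (mul_div_cancel₀ _ hpE).symm)
  rw [hx, hx'] at key
  have hpR : (p : ℝ) ≠ 0 := by exact_mod_cast hp.ne_zero
  have h4 : Real.log 4 = 2 * Real.log 2 := by
    rw [show (4 : ℝ) = 2 ^ 2 by norm_num, Real.log_pow]
    norm_num
  rw [Real.log_div hpR (by norm_num), h4]
  linarith

theorem rpow_le_mulHeight {p : ℕ} (hp : p ≠ 0) {γ : ℂ} (h : Real.log (p / 4) / 4 ≤ algHeight γ) :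
    ((p : ℝ) / 4) ^ ((1 : ℝ) / 4) ≤ mulHeight γ := by
  have : (0 : ℝ) < p / 4 := by positivity
  rw [mulHeight, Real.rpow_def_of_pos this, Real.exp_le_exp]
  linarith

end QuadraticStep

section RootTower

theorem algHeight_of_pow_eq_three {θ : ℂ} {m : ℕ} (hm : m ≠ 0) (hθ : θ ^ m = 3) :
    algHeight θ = Real.log 3 / m := by
  have hθint : IsIntegral ℤ θ := by
    refine IsIntegral.of_pow (Nat.pos_of_ne_zero hm) ?_
    rw [hθ]
    exact_mod_cast isIntegral_algebraMap (R := ℤ) (A := ℂ) (x := 3)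
  have hfin : FiniteDimensional ℚ ℚ⟮θ⟯ := adjoin.finiteDimensional hθint.tower_top
  have : NumberField ℚ⟮θ⟯ := ⟨⟩
  have hgen : IsIntegral ℤ (AdjoinSimple.gen ℚ θ) :=
    (isIntegral_algebraMap_iff (algebraMap ℚ⟮θ⟯ ℂ).injective).mp hθint
  have hgenpow : AdjoinSimple.gen ℚ θ ^ m = 3 := by
    apply (algebraMap ℚ⟮θ⟯ ℂ).injective
    rw [map_pow, map_ofNat]
    exact hθ
  have hm' : (m : ℝ) ≠ 0 := by exact_mod_cast hm
  have htop : denomIdeal ℚ⟮θ⟯ (AdjoinSimple.gen ℚ θ) = ⊤ := by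
    rw [Ideal.eq_top_iff_one, mem_denomIdeal]
    simpa using hgen
  have hlog (φ : ℚ⟮θ⟯ →+* ℂ) :
      Real.log (max 1 ‖φ (AdjoinSimple.gen ℚ θ)‖) = Real.log 3 / m := by
    have hnorm : ‖φ (AdjoinSimple.gen ℚ θ)‖ ^ m = 3 := by
      rw [← norm_pow, ← map_pow, hgenpow, map_ofNat]
      simp
    have h1 : 1 ≤ ‖φ (AdjoinSimple.gen ℚ θ)‖ := by
      by_contra! hlt
      have := pow_le_one₀ (n := m) (norm_nonneg _) hlt.le
      linarith
    rw [max_eq_right h1, eq_div_iff hm', mul_comm, ← Real.log_pow, hnorm]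
  have hD : (Module.finrank ℚ ℚ⟮θ⟯ : ℝ) ≠ 0 := by exact_mod_cast Module.finrank_pos.ne'
  apply mul_left_cancel₀ hD
  rw [algHeight_eq hθint.tower_top, finrank_mul_nfHeight, htop, Ideal.absNorm_top, Nat.cast_one,
    Real.log_one, add_zero, Finset.sum_congr rfl fun φ _ => hlog φ, Finset.sum_const,
    Finset.card_univ, Embeddings.card, nsmul_eq_mul]

theorem rootThree_pow (n : ℕ) :
    ((((3 : ℝ) ^ (((3 : ℝ) ^ n)⁻¹) : ℝ) : ℂ)) ^ 3 ^ n = 3 := by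
  rw [← Complex.ofReal_pow, ← Real.rpow_natCast, ← Real.rpow_mul (by norm_num)]
  push_cast
  rw [inv_mul_cancel₀ (by positivity), Real.rpow_one]
  norm_num

theorem monotone_adjoin_rootThree :
    Monotone fun n : ℕ => ℚ⟮((((3 : ℝ) ^ (((3 : ℝ) ^ (n + 1 : ℕ))⁻¹) : ℝ) : ℂ))⟯ := by
  refine monotone_nat_of_le_succ fun n => ?_
  rw [adjoin_simple_le_iff]
  have : ((((3 : ℝ) ^ (((3 : ℝ) ^ (n + 1 : ℕ))⁻¹) : ℝ) : ℂ)) =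
      ((((3 : ℝ) ^ (((3 : ℝ) ^ (n + 1 + 1 : ℕ))⁻¹) : ℝ) : ℂ)) ^ 3 := by
    rw [← Complex.ofReal_pow, ← Real.rpow_mul_natCast (by norm_num), pow_succ _ (n + 1),
      mul_inv, mul_assoc]
    norm_num
  rw [this]
  exact pow_mem (mem_adjoin_simple_self ℚ _) 3

theorem not_hasBogomolovProperty_of_rootThree_mem {K : IntermediateField ℚ ℂ}
    (hK : ∀ n : ℕ, ((((3 : ℝ) ^ (((3 : ℝ) ^ (n + 1 : ℕ))⁻¹) : ℝ) : ℂ)) ∈ K) :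
    ¬ HasBogomolovProperty K := by
  rintro ⟨ε, hε, h⟩
  have h3 : 0 < Real.log 3 := Real.log_pos (by norm_num)
  obtain ⟨n, hn⟩ := pow_unbounded_of_one_lt (Real.log 3 / ε) (by norm_num : (1 : ℝ) < 3)
  have hroot := rootThree_pow (n + 1)
  have hheight := algHeight_of_pow_eq_three (by positivity) hroot
  push_cast at hheight
  refine h _ (hK n) ?_ ⟨?_, ?_⟩
  · intro h0
    rw [h0, zero_pow (by positivity)] at hroot
    exact three_ne_zero hroot.symm
  · rw [hheight]
    positivity
  · rw [hheight, div_lt_comm₀ (by positivity) hε]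
    exact hn.trans (pow_lt_pow_right₀ (by norm_num) n.lt_succ_self)

end RootTower

end RelBogomolov

open RelBogomolov

/-- Example: `K = ⋃_n ℚ(3^{1/3^n})` fails (B); adjoining square roots of increasing primes
`p_n ≡ 3 (mod 4)` greater than `3` gives an infinite tower `K = K_0 ⊆ K_1 ⊆ ⋯` with union `L`
such that every `γ ∈ K_n^× \ K_{n-1}` satisfies `H(γ) ≥ (p_n/4)^{1/4}`; hence every
`γ ∈ L^× \ K^×` has `H(γ) ≥ (p_1/4)^{1/4}` and `L/K` is an infinite Bogomolov extension. -/
theorem infinite_bogomolovExtension_of_sqrt_primes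
    (p : ℕ → ℕ) (hp : ∀ n, (p n).Prime) (hmono : StrictMono p)
    (hp0 : 3 < p 0) (hp4 : ∀ n, p n % 4 = 3)
    (K : IntermediateField ℚ ℂ)
    (hK : K = ⨆ n : ℕ, ℚ⟮((((3 : ℝ) ^ (((3 : ℝ) ^ (n + 1 : ℕ))⁻¹) : ℝ) : ℂ))⟯)
    (Kseq : ℕ → IntermediateField ℚ ℂ) (h0 : Kseq 0 = K)
    (hrec : ∀ n : ℕ, Kseq (n + 1) = Kseq n ⊔ ℚ⟮((Real.sqrt (p n) : ℝ) : ℂ)⟯)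
    (L : IntermediateField ℚ ℂ) (hLdef : L = ⨆ n : ℕ, Kseq n) (hKL : K ≤ L) :
    (∀ n : ℕ, ∀ γ : ℂ, γ ∈ Kseq (n + 1) → γ ≠ 0 → γ ∉ Kseq n →
        ((p n : ℝ) / 4) ^ ((1 : ℝ) / 4) ≤ mulHeight γ) ∧
    (∀ γ : ℂ, γ ∈ L → γ ≠ 0 → γ ∉ K →
        ((p 0 : ℝ) / 4) ^ ((1 : ℝ) / 4) ≤ mulHeight γ) ∧
    IsBogomolovExtension K L ∧
    ¬ FiniteDimensional ↥K ↥(extendScalars hKL) ∧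
    ¬ HasBogomolovProperty K := by
  have hpne (n : ℕ) : p n ≠ 2 ∧ p n ≠ 3 := by
    have := hmono.monotone (Nat.zero_le n)
    omega
  have hsq (n : ℕ) : ((Real.sqrt (p n) : ℝ) : ℂ) ^ 2 = (p n : ℂ) := by
    rw [← Complex.ofReal_pow, Real.sq_sqrt (Nat.cast_nonneg _), Complex.ofReal_natCast]
  have hKmono : Monotone Kseq := monotone_nat_of_le_succ fun n => by
    rw [hrec]
    exact le_sup_left
  have hroot (n : ℕ) : ((((3 : ℝ) ^ (((3 : ℝ) ^ (n + 1 : ℕ))⁻¹) : ℝ) : ℂ)) ∈ K := by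
    rw [hK]
    exact le_iSup (fun n : ℕ => ℚ⟮((((3 : ℝ) ^ (((3 : ℝ) ^ (n + 1 : ℕ))⁻¹) : ℝ) : ℂ))⟯) n
      (mem_adjoin_simple_self ℚ _)
  have halg (n : ℕ) : Kseq n ≤ algebraicClosure ℚ ℂ := by
    induction n with
    | zero =>
      rw [h0, hK]
      refine iSup_le fun n => adjoin_simple_le_iff.mpr ?_
      rw [mem_algebraicClosure_iff']
      refine IsIntegral.of_pow (n := 3 ^ (n + 1)) (by positivity) ?_
      rw [rootThree_pow]
      exact_mod_cast isIntegral_algebraMap (R := ℚ) (A := ℂ) (x := 3)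
    | succ n ih =>
      rw [hrec]
      refine sup_le ih (adjoin_simple_le_iff.mpr ?_)
      rw [mem_algebraicClosure_iff']
      refine IsIntegral.of_pow two_pos ?_
      rw [hsq]
      exact_mod_cast isIntegral_algebraMap (R := ℚ) (A := ℂ) (x := (p n : ℚ))
  have hunr (q : ℕ) (hq : q.Prime) (hq2 : q ≠ 2) (hq3 : q ≠ 3) (n : ℕ)
      (hne : ∀ i < n, q ≠ p i) : IntegralOfMulSq q (Kseq n) := by
    induction n with
    | zero =>
      rw [h0, hK]
      exact integralOfMulSq_iSup monotone_adjoin_rootThree fun n =>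
        integralOfMulSq_adjoin_root_three hq hq3 (rootThree_pow (n + 1))
    | succ n ih =>
      rw [hrec]
      refine (ih fun i hi => hne i (by omega)).sup_adjoin_sqrt (Nat.Coprime.mul_right ?_ ?_) (hsq n)
      · exact (Nat.coprime_primes hq Nat.prime_two).mpr hq2
      · exact (Nat.coprime_primes hq (hp n)).mpr (hne n n.lt_succ_self)
  have hunr' (n : ℕ) : IntegralOfMulSq (p n) (Kseq n) :=
    hunr _ (hp n) (hpne n).1 (hpne n).2 n fun i hi => (hmono hi).ne'
  have hstep (n : ℕ) (γ : ℂ) (hγ : γ ∈ Kseq (n + 1)) (hγn : γ ∉ Kseq n) :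
      Real.log (p n / 4) / 4 ≤ algHeight γ := by
    rw [hrec] at hγ
    exact (hunr' n).log_le_algHeight (hp n)
      (fun x hx => mem_algebraicClosure_iff'.mp (halg n hx)) (hsq n) hγ hγn
  have hL (γ : ℂ) (hγ : γ ∈ L) (hγK : γ ∉ K) : Real.log (p 0 / 4) / 4 ≤ algHeight γ := by
    rw [hLdef, ← SetLike.mem_coe, coe_iSup_of_directed hKmono.directed_le, Set.mem_iUnion] at hγ
    obtain ⟨n, hn⟩ := hγ
    induction n with
    | zero => exact absurd (h0 ▸ hn) hγK
    | succ n ih =>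
      by_cases hγn : γ ∈ Kseq n
      · exact ih hγn
      · refine le_trans ?_ (hstep n γ hn hγn)
        have h1 : (p 0 : ℝ) ≤ p n := by exact_mod_cast hmono.monotone (Nat.zero_le n)
        have h2 : (0 : ℝ) < p 0 := by exact_mod_cast (hp 0).pos
        gcongr
  refine ⟨fun n γ hγ _ hγn => rpow_le_mulHeight (hp n).ne_zero (hstep n γ hγ hγn),
    fun γ hγ _ hγK => rpow_le_mulHeight (hp 0).ne_zero (hL γ hγ hγK), ?_, ?_,
    not_hasBogomolovProperty_of_rootThree_mem hroot⟩
  · refine ⟨Real.log (p 0 / 4) / 4, ?_, fun γ hγ _ _ hlt => ?_⟩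
    · have h5 : (5 : ℝ) ≤ p 0 := by exact_mod_cast (show 5 ≤ p 0 by have := hp4 0; omega)
      exact div_pos (Real.log_pos (by linarith)) (by norm_num)
    · by_contra hγK
      exact absurd (hL γ hγ hγK) (not_le.mpr hlt)
  · intro hfin
    have hKle (n : ℕ) : K ≤ Kseq n := h0 ▸ hKmono (Nat.zero_le n)
    let T : ℕ →o Submodule K (extendScalars hKL) :=
      { toFun := fun n => (Subalgebra.toSubmodule (extendScalars (hKle n)).toSubalgebra).comap
          (extendScalars hKL).val.toLinearMap
        monotone' := fun m n hmn x hx => hKmono hmn hx }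
    obtain ⟨n, hn⟩ := monotone_stabilizes_iff_noetherian.mpr
      (inferInstance : IsNoetherian K (extendScalars hKL)) T
    have hmem : ((Real.sqrt (p n) : ℝ) : ℂ) ∈ Kseq (n + 1) := by
      rw [hrec]
      exact le_sup_right (a := Kseq n) (mem_adjoin_simple_self ℚ _)
    have hmemL : ((Real.sqrt (p n) : ℝ) : ℂ) ∈ L := by
      rw [hLdef]
      exact le_iSup Kseq (n + 1) hmem
    have hT : (⟨((Real.sqrt (p n) : ℝ) : ℂ), hmemL⟩ : extendScalars hKL) ∈ T n := by
      rw [hn (n + 1) n.le_succ]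
      exact hmem
    exact (hunr' n).sqrt_notMem (hp n) (hsq n) hT
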